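/- arXiv:0808.2463 — 3 statements merged into one kernel-verified Lean document; each statement's English description precedes it below -/
import Mathlib

section
/- Let G be a group, n a positive integer, and ψ : G → U(n) a group homomorphism such that for every unitary matrix U ∈ U(n) there exists ξ ∈ ℝ with e^{2πiξ}·U lying in the closure of the image of ψ. Then the closure of the image of ψ is a normal subgroup of U(n). -/
/-- A subgroup of the unitary group that contains a unit-modulus multiple of every unitary matrix
is normal, since scalars are central. -/
theorem Matrix.unitaryGroup.normal_of_forall_exists_smul_mem {m : Type*} [Fintype m]
    [DecidableEq m] (H : Subgroup (Matrix.unitaryGroup m ℂ))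
    (hH : ∀ U : Matrix.unitaryGroup m ℂ, ∃ c : ℂ, c * star c = 1 ∧
      ∃ V ∈ H, (V : Matrix m m ℂ) = c • (U : Matrix m m ℂ)) : H.Normal := by
  refine ⟨fun h hh U => ?_⟩
  obtain ⟨c, hc, V, hV, hVU⟩ := hH U
  have key : U * h * U⁻¹ = V * h * V⁻¹ := by
    apply Subtype.ext
    have hc' : starRingEnd ℂ c * c = 1 := by rw [mul_comm]; exact hc
    simp [hVU, smul_smul, hc']
  rw [key]
  exact H.mul_mem (H.mul_mem hV hh) (H.inv_mem hV)

/-- A scalar of the form `exp (2πiξ)` has unit modulus. -/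
theorem Complex.exp_two_pi_I_mul_star_self (ξ : ℝ) :
    Complex.exp (2 * Real.pi * Complex.I * ξ) *
      star (Complex.exp (2 * Real.pi * Complex.I * ξ)) = 1 := by
  rw [Complex.star_def, ← Complex.exp_conj, ← Complex.exp_add]
  simp [Complex.conj_ofNat]

theorem stmt_2 {G : Type*} [Group G] (n : ℕ) (hn : 0 < n)
    (ψ : G →* Matrix.unitaryGroup (Fin n) ℂ)
    (hψ : ∀ U : Matrix.unitaryGroup (Fin n) ℂ, ∃ ξ : ℝ,
      Complex.exp (2 * Real.pi * Complex.I * ξ) • (U : Matrix (Fin n) (Fin n) ℂ) ∈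
        closure (Set.range fun g => (ψ g : Matrix (Fin n) (Fin n) ℂ))) :
    ∃ H : Subgroup (Matrix.unitaryGroup (Fin n) ℂ), H.Normal ∧
      (H : Set (Matrix.unitaryGroup (Fin n) ℂ)) = closure (Set.range ψ) := by
  refine ⟨ψ.range.topologicalClosure, ?_, by
    rw [Subgroup.topologicalClosure_coe, MonoidHom.coe_range]⟩
  refine Matrix.unitaryGroup.normal_of_forall_exists_smul_mem _ fun U => ?_
  obtain ⟨ξ, hξ⟩ := hψ U
  have hc := Complex.exp_two_pi_I_mul_star_self ξ
  refine ⟨_, hc, ⟨_, Matrix.mem_unitaryGroup_iff.mpr ?_⟩, ?_, rfl⟩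
  · rw [star_smul, smul_mul_smul_comm, hc, one_smul, Matrix.mem_unitaryGroup_iff.mp U.2]
  · rw [← SetLike.mem_coe, Subgroup.topologicalClosure_coe, MonoidHom.coe_range, closure_subtype,
      ← Set.range_comp]
    exact hξ
end

section
/- Let n ≥ 2, let G be a group, and let ψ : G → U(n) be a group homomorphism such that for every unitary matrix U ∈ U(n) there exists ξ ∈ ℝ with e^{2πiξ}·U lying in the closure of the image of ψ. Then there exist an irrational real number θ and a sequence (g_k) of elements of G such that the (1,1)-entries of ψ(g_k) converge to e^{2πiθ}. -/
/-- The commutator of a diagonal matrix `d` with the permutation matrix of a transposition `(i j)`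
has `(i, i)`-entry `d i * star (d j)`. -/
theorem diagonal_commutator_swap_apply {ι : Type*} [Fintype ι] [DecidableEq ι] (d : ι → ℂ)
    (i j : ι) :
    (Matrix.diagonal d * (Equiv.swap i j).permMatrix ℂ * star (Matrix.diagonal d) *
      star ((Equiv.swap i j).permMatrix ℂ)) i i = d i * star (d j) := by
  rw [Matrix.star_eq_conjTranspose, Matrix.star_eq_conjTranspose, Matrix.conjTranspose_permMatrix,
    Matrix.diagonal_conjTranspose, Matrix.mul_apply, Finset.sum_eq_single j]
  · simp [Matrix.mul_diagonal, Matrix.diagonal_mul, Equiv.Perm.permMatrix, PEquiv.toMatrix_apply]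
  · intro k _ hk
    have h : Equiv.swap i j k ≠ i := fun h => hk (by simpa using congrArg (Equiv.swap i j) h)
    simp [Equiv.Perm.permMatrix, PEquiv.toMatrix_apply, h]
  · simp

/-- The commutator of two matrices is unchanged when they are multiplied by phases. -/
theorem commutator_smul_smul {ι : Type*} [Fintype ι] (a b : ℂ) (ha : a * star a = 1)
    (hb : b * star b = 1) (D P : Matrix ι ι ℂ) :
    (a • D) * (b • P) * star (a • D) * star (b • P) = D * P * star D * star P := by
  simp only [star_smul, Matrix.smul_mul, Matrix.mul_smul, smul_smul]
  rw [show star b * (star a * (b * a)) = (a * star a) * (b * star b) by ring, ha, hb]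
  simp

theorem exp_two_pi_I_mul_star (x : ℝ) :
    Complex.exp (2 * Real.pi * Complex.I * x) * star (Complex.exp (2 * Real.pi * Complex.I * x)) =
      1 := by
  rw [Complex.star_def, ← Complex.exp_conj, ← Complex.exp_add]
  simp [Complex.conj_ofNat]

theorem stmt_4 {G : Type*} [Group G] (n : ℕ) (hn : 2 ≤ n)
    (ψ : G →* Matrix.unitaryGroup (Fin n) ℂ)
    (hψ : ∀ U : Matrix.unitaryGroup (Fin n) ℂ, ∃ ξ : ℝ,
      Complex.exp (2 * Real.pi * Complex.I * ξ) • (U : Matrix (Fin n) (Fin n) ℂ) ∈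
        closure (Set.range fun g => (ψ g : Matrix (Fin n) (Fin n) ℂ))) :
    ∃ (θ : ℝ) (g : ℕ → G), Irrational θ ∧
      Filter.Tendsto
        (fun k => (ψ (g k) : Matrix (Fin n) (Fin n) ℂ) ⟨0, by omega⟩ ⟨0, by omega⟩)
        Filter.atTop
        (nhds (Complex.exp (2 * Real.pi * Complex.I * θ))) := by
  set i : Fin n := ⟨0, by omega⟩
  let j : Fin n := ⟨1, by omega⟩
  have hij : j ≠ i := by simp [i, j, Fin.ext_iff]
  set z : ℂ := Complex.exp (2 * Real.pi * Complex.I * (√2 : ℝ))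
  have hzz : z * star z = 1 := exp_two_pi_I_mul_star _
  let d : Fin n → ℂ := Function.update 1 i z
  have hD : Matrix.diagonal d ∈ Matrix.unitaryGroup (Fin n) ℂ := by
    rw [Matrix.mem_unitaryGroup_iff, Matrix.star_eq_conjTranspose, Matrix.diagonal_conjTranspose,
      Matrix.diagonal_mul_diagonal, ← Matrix.diagonal_one]
    congr 1
    ext k
    by_cases hk : k = i
    · subst hk
      simpa [d] using hzz
    · simp [d, hk]
  have hP : (Equiv.swap i j).permMatrix ℂ ∈ Matrix.unitaryGroup (Fin n) ℂ := by
    rw [Matrix.mem_unitaryGroup_iff, Matrix.star_eq_conjTranspose,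
      Matrix.conjTranspose_permMatrix, ← Matrix.permMatrix_mul]
    simp
  obtain ⟨ξ, hξ⟩ := hψ ⟨_, hD⟩
  obtain ⟨η, hη⟩ := hψ ⟨_, hP⟩
  let f : Matrix (Fin n) (Fin n) ℂ → Matrix (Fin n) (Fin n) ℂ → ℂ :=
    fun X Y => (X * Y * star X * star Y) i i
  have hf : Continuous (Function.uncurry f) := by
    have h : Continuous fun p : Matrix (Fin n) (Fin n) ℂ × Matrix (Fin n) (Fin n) ℂ =>
        p.1 * p.2 * star p.1 * star p.2 := by fun_prop
    exact h.matrix_elem i i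
  have hmem := map_mem_closure₂ (u := Set.range fun g => (ψ g : Matrix (Fin n) (Fin n) ℂ) i i)
    hf hξ hη (by
      rintro _ ⟨g, rfl⟩ _ ⟨h, rfl⟩
      refine ⟨g * h * g⁻¹ * h⁻¹, ?_⟩
      simp [f, Matrix.star_eq_conjTranspose])
  have hval : f (Complex.exp (2 * Real.pi * Complex.I * ξ) • Matrix.diagonal d)
      (Complex.exp (2 * Real.pi * Complex.I * η) • (Equiv.swap i j).permMatrix ℂ) = z := by
    simp only [f]
    rw [commutator_smul_smul _ _ (exp_two_pi_I_mul_star ξ) (exp_two_pi_I_mul_star η),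
      diagonal_commutator_swap_apply]
    simp [d, hij]
  rw [hval] at hmem
  obtain ⟨x, hx, hlim⟩ := mem_closure_iff_seq_limit.1 hmem
  choose g hg using hx
  exact ⟨√2, g, irrational_sqrt_two, by simpa only [hg] using hlim⟩
end

section
/- Let r be a prime number with r ≥ 5. Then for every positive integer n, the complex number (r − i·√r)^n is not a real number (its imaginary part is nonzero). -/
theorem natCast_sub_I_mul_sqrt_mul (r : ℕ) (a b : ℂ) :
    (a + b * (Complex.I * Real.sqrt r)) * ((r : ℂ) - Complex.I * Real.sqrt r) =
      (r * (a + b)) + (r * b - a) * (Complex.I * Real.sqrt r) := by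
  have hs : ((Real.sqrt r : ℝ) : ℂ) ^ 2 = r := by
    rw [← Complex.ofReal_pow, Real.sq_sqrt r.cast_nonneg, Complex.ofReal_natCast]
  linear_combination (-b * (Real.sqrt r : ℂ) ^ 2) * Complex.I_sq + b * hs

/-- If an odd prime `q` divides `r + 1`, then modulo `q` both coordinates of a positive power of
`r - i√r` agree and are nonzero. -/
theorem exists_pow_eq_of_odd_prime_dvd {r q : ℕ} (hq : q.Prime) (hodd : Odd q)
    (hdvd : q ∣ r + 1) (n : ℕ) :
    ∃ a b : ℤ, ((r : ℂ) - Complex.I * Real.sqrt r) ^ (n + 1) =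
      a + b * (Complex.I * Real.sqrt r) ∧ (q : ℤ) ∣ a - b ∧ ¬ (q : ℤ) ∣ b := by
  have hq' : Prime (q : ℤ) := Nat.prime_iff_prime_int.mp hq
  have hdvd' : (q : ℤ) ∣ r + 1 := by exact_mod_cast hdvd
  induction n with
  | zero =>
    refine ⟨r, -1, by push_cast; ring, by simpa using hdvd', ?_⟩
    rw [dvd_neg]
    exact fun h ↦ hq'.not_isUnit (isUnit_of_dvd_one h)
  | succ n ih =>
    obtain ⟨a, b, h, hab, hb⟩ := ih
    refine ⟨r * (a + b), r * b - a, ?_, ?_, fun hc ↦ ?_⟩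
    · rw [pow_succ, h, natCast_sub_I_mul_sqrt_mul]
      push_cast
      ring
    · rw [show (r * (a + b) - (r * b - a) : ℤ) = (r + 1) * a by ring]
      exact hdvd'.mul_right a
    · have h2b : (q : ℤ) ∣ 2 * b := by
        rw [show 2 * b = (r + 1) * b - (a - b) - (r * b - a) by ring]
        exact ((hdvd'.mul_right b).sub hab).sub hc
      rcases hq'.dvd_or_dvd h2b with h2 | h2
      · have : q ∣ 2 := by exact_mod_cast h2
        rw [(Nat.prime_dvd_prime_iff_eq hq Nat.prime_two).mp this] at hodd
        exact absurd hodd (by decide)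
      · exact hb h2

/-- If `8 ∣ r + 1`, then `(r - i√r) ^ (n + 1)` is `2 ^ n` times an element with odd
coordinates. -/
theorem exists_pow_eq_of_eight_dvd {r : ℕ} (hdvd : 8 ∣ r + 1) (n : ℕ) :
    ∃ a b : ℤ, ((r : ℂ) - Complex.I * Real.sqrt r) ^ (n + 1) =
      2 ^ n * (a + b * (Complex.I * Real.sqrt r)) ∧ 4 ∣ a - b ∧ Odd b := by
  obtain ⟨k, hk⟩ := hdvd
  have hr : (r : ℤ) = 8 * k - 1 := by lia
  induction n with
  | zero => exact ⟨r, -1, by push_cast; ring, by lia, by decide⟩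
  | succ n ih =>
    obtain ⟨a, b, h, ⟨c, hc⟩, ⟨d, hd⟩⟩ := ih
    obtain rfl : a = b + 4 * c := by lia
    have hrC : (r : ℂ) = 8 * k - 1 := by exact_mod_cast congrArg (Int.cast : ℤ → ℂ) hr
    refine ⟨r * (b + 2 * c), 4 * k * b - b - 2 * c, ?_, ⟨k * (b + 4 * c), ?_⟩,
      ⟨2 * k * b - d - 1 - c, ?_⟩⟩
    · rw [pow_succ, h, mul_assoc, natCast_sub_I_mul_sqrt_mul]
      push_cast
      linear_combination (2 ^ n * b * (Complex.I * Real.sqrt r)) * hrC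
    · rw [hr]
      ring
    · linear_combination -hd

theorem im_intCast_add_intCast_mul_ne_zero {r : ℕ} (hr : 0 < r) (a : ℤ) {b : ℤ} (hb : b ≠ 0) :
    ((a : ℂ) + b * (Complex.I * Real.sqrt r)).im ≠ 0 := by
  simp [hb, hr.ne']

theorem stmt_11 (r : ℕ) (hp : r.Prime) (hr : 5 ≤ r) :
    ∀ n : ℕ, 0 < n → (((r : ℂ) - Complex.I * Real.sqrt r) ^ n).im ≠ 0 := by
  intro n hn
  obtain ⟨n, rfl⟩ := Nat.exists_eq_add_one.mpr hn
  rcases Nat.eq_two_pow_or_exists_odd_prime_and_dvd (r + 1) with ⟨k, hk⟩ | ⟨q, hq, hdvd, hodd⟩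
  · have h3 : 3 ≤ k := by
      by_contra! h
      have : 2 ^ k ≤ 2 ^ 2 := Nat.pow_le_pow_right two_pos (by lia)
      lia
    have h8 : 8 ∣ r + 1 := hk ▸ pow_dvd_pow 2 h3
    obtain ⟨a, b, h, -, hb⟩ := exists_pow_eq_of_eight_dvd h8 n
    have hb0 : b ≠ 0 := by
      rintro rfl
      exact absurd hb (by decide)
    have h2 : (2 : ℂ) ^ n = ((2 ^ n : ℝ) : ℂ) := by push_cast; rfl
    rw [h, h2, Complex.im_ofReal_mul]
    exact mul_ne_zero (by positivity) (im_intCast_add_intCast_mul_ne_zero hp.pos a hb0)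
  · obtain ⟨a, b, h, -, hb⟩ := exists_pow_eq_of_odd_prime_dvd hq hodd hdvd n
    rw [h]
    exact im_intCast_add_intCast_mul_ne_zero hp.pos a fun h0 ↦ hb (h0 ▸ dvd_zero _)
end
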